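/- arXiv:1808.01659 — 5 statements merged into one kernel-verified Lean document; each statement's English description precedes it below -/
import Mathlib

section
/- For every separable real Banach space B there exist a real Hilbert space H̃ and a continuous injective linear map ι : B → H̃ with dense range such that ‖ι x‖_{H̃} ≤ ‖x‖_B for all x ∈ B. In particular, the norm induced on B by the inner product of H̃ is weaker than the original norm of B, and B is continuously embedded in H̃. -/
open scoped ENNReal in
/-- A sequence of functionals of norm at most one defines a contraction into `ℓ²`, by weighting
the `n`-th functional with `2⁻⁽ⁿ⁺¹⁾`. -/
theorem exists_contraction_lp_two_of_norm_le_one {E : Type*} [NormedAddCommGroup E]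
    [NormedSpace ℝ E] (g : ℕ → StrongDual ℝ E) (hg : ∀ n, ‖g n‖ ≤ 1) :
    ∃ T : E →ₗ[ℝ] lp (fun _ : ℕ => ℝ) 2,
      (∀ x n, T x n = (1 / 2) ^ (n + 1) * g n x) ∧ ∀ x, ‖T x‖ ≤ ‖x‖ := by
  have hp : (2 : ℝ≥0∞).toReal = 2 := by norm_num
  have hbound (x : E) (s : Finset ℕ) :
      ∑ n ∈ s, ‖((1 / 2 : ℝ) ^ (n + 1) * g n x)‖ ^ (2 : ℝ≥0∞).toReal
        ≤ ‖x‖ ^ (2 : ℝ≥0∞).toReal := by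
    simp only [hp, Real.rpow_two]
    have hterm (n : ℕ) : ‖((1 / 2 : ℝ) ^ (n + 1) * g n x)‖ ^ 2 ≤ ‖x‖ ^ 2 / 2 / 2 ^ n := by
      have hgx : ‖g n x‖ ≤ ‖x‖ := (g n).le_of_opNorm_le (hg n) x |>.trans_eq (one_mul _)
      have hc : ((1 / 2 : ℝ) ^ (n + 1)) ^ 2 ≤ (1 / 2) ^ (n + 1) :=
        pow_le_of_le_one (by positivity) (pow_le_one₀ (by norm_num) (by norm_num)) two_ne_zero
      rw [norm_mul, mul_pow, norm_pow, Real.norm_of_nonneg (by norm_num : (0 : ℝ) ≤ 1 / 2)]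
      calc ((1 / 2 : ℝ) ^ (n + 1)) ^ 2 * ‖g n x‖ ^ 2 ≤ (1 / 2) ^ (n + 1) * ‖x‖ ^ 2 := by gcongr
        _ = ‖x‖ ^ 2 / 2 / 2 ^ n := by rw [one_div, inv_pow, pow_succ]; field_simp
    calc _ ≤ ∑ n ∈ s, ‖x‖ ^ 2 / 2 / 2 ^ n := Finset.sum_le_sum fun n _ => hterm n
      _ ≤ ∑' n, ‖x‖ ^ 2 / 2 / 2 ^ n :=
        (summable_geometric_two' _).sum_le_tsum s fun n _ => by positivity
      _ = ‖x‖ ^ 2 := tsum_geometric_two' _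
  refine ⟨{ toFun := fun x => ⟨fun n => (1 / 2) ^ (n + 1) * g n x, memℓp_gen' (hbound x)⟩
            map_add' := fun x y => ?_
            map_smul' := fun c x => ?_ }, fun _ _ => rfl, fun x => ?_⟩
  · ext n
    change (1 / 2 : ℝ) ^ (n + 1) * g n (x + y)
      = (1 / 2) ^ (n + 1) * g n x + (1 / 2) ^ (n + 1) * g n y
    rw [map_add, mul_add]
  · ext n
    change (1 / 2 : ℝ) ^ (n + 1) * g n (c • x) = c * ((1 / 2) ^ (n + 1) * g n x)
    rw [map_smul, smul_eq_mul]
    ring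
  · exact lp.norm_le_of_forall_sum_le (by norm_num) (norm_nonneg x) (hbound x)

/-- On a separable normed space, countably many functionals of norm at most one separate points
from zero. -/
theorem exists_seq_strongDual_separating (E : Type*) [NormedAddCommGroup E] [NormedSpace ℝ E]
    [TopologicalSpace.SeparableSpace E] :
    ∃ g : ℕ → StrongDual ℝ E, (∀ n, ‖g n‖ ≤ 1) ∧ ∀ x, (∀ n, g n x = 0) → x = 0 := by
  choose g hg hgu using fun n => exists_dual_vector'' ℝ (TopologicalSpace.denseSeq E n)
  refine ⟨g, hg, fun x hx => ?_⟩
  refine norm_le_zero_iff.mp (le_of_forall_pos_le_add fun ε hε => ?_)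
  obtain ⟨n, hn⟩ := (TopologicalSpace.denseRange_denseSeq E).exists_dist_lt x (half_pos hε)
  set u := TopologicalSpace.denseSeq E n
  rw [dist_eq_norm] at hn
  have hu : ‖u‖ ≤ ‖x - u‖ := by
    have h := (g n).le_of_opNorm_le (hg n) (x - u)
    rwa [map_sub, hx n, hgu n, zero_sub, norm_neg, one_mul, RCLike.ofReal_real_eq_id, id,
      norm_norm] at h
  have hxu : ‖x‖ ≤ ‖x - u‖ + ‖u‖ := by simpa using norm_add_le (x - u) u
  linarith

/-- Kuelbs' lemma: every separable real Banach space `B` embeds continuously,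
injectively and densely into a real Hilbert space `H̃`, with `‖ι x‖ ≤ ‖x‖`. -/
theorem kuelbs_embedding (B : Type) [NormedAddCommGroup B] [NormedSpace ℝ B]
    [CompleteSpace B] [TopologicalSpace.SeparableSpace B] :
    ∃ (H : Type) (_ : NormedAddCommGroup H) (_ : InnerProductSpace ℝ H)
      (_ : CompleteSpace H) (ι : B →ₗ[ℝ] H),
        Continuous ι ∧ Function.Injective ι ∧ DenseRange ι ∧
          ∀ x : B, ‖ι x‖ ≤ ‖x‖ := by
  obtain ⟨g, hg, hsep⟩ := exists_seq_strongDual_separating B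
  obtain ⟨T, hT, hnorm⟩ := exists_contraction_lp_two_of_norm_le_one g hg
  let K := (LinearMap.range T).topologicalClosure
  let ι : B →ₗ[ℝ] K := T.codRestrict K fun x =>
    (LinearMap.range T).le_topologicalClosure (LinearMap.mem_range_self T x)
  have hι (x : B) : ‖ι x‖ ≤ ‖x‖ := hnorm x
  refine ⟨K, inferInstance, inferInstance,
    (LinearMap.range T).isClosed_topologicalClosure.completeSpace_coe, ι, ?_, ?_, ?_, hι⟩
  · exact (ι.mkContinuous 1 fun x => by simpa using hι x).continuous
  · refine (injective_iff_map_eq_zero ι).mpr fun x hx => hsep x fun n => ?_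
    have h : T x = 0 := congrArg Subtype.val hx
    have hn := hT x n
    rw [h] at hn
    simpa using hn.symm
  · intro y
    rw [closure_subtype, ← Set.range_comp]
    exact y.2
end

section
/- Let B be a real normed space, (F_n)_{n≥1} a sequence of continuous linear functionals on B with ‖F_n‖ ≤ 1 for all n and ‖x‖_B = sup_{n≥1} |F_n(x)| for all x ∈ B, and (t_n)_{n≥1} a sequence of strictly positive reals with Σ_{n=1}^∞ t_n = 1. Then: (i) for all x, y ∈ B the series Σ_{n=1}^∞ t_n F_n(x) F_n(y) converges absolutely; (ii) the map (x, y) ↦ Σ_{n=1}^∞ t_n F_n(x) F_n(y) is a symmetric bilinear positive-definite form (an inner product) on B; and (iii) the induced norm satisfies ‖x‖_{H̃}² := Σ_{n=1}^∞ t_n {F_n(x)}² ≤ ‖x‖_B² for every x ∈ B. -/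
/-- The explicit inner product of Kuelbs' construction:
`⟨x, y⟩ = Σ t n * F n x * F n y` converges absolutely, is a symmetric bilinear
positive-definite form on `B`, and its norm is dominated by the `B`-norm. -/
theorem kuelbs_inner_product (B : Type) [NormedAddCommGroup B] [NormedSpace ℝ B]
    (F : ℕ → (B →L[ℝ] ℝ)) (hF : ∀ n, ‖F n‖ ≤ 1)
    (hnorm : ∀ x : B, ‖x‖ = ⨆ n, |F n x|)
    (t : ℕ → ℝ) (ht : ∀ n, 0 < t n) (hsum : HasSum t 1) :
    (∀ x y : B, Summable fun n => |t n * F n x * F n y|) ∧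
    (∀ x y : B, (∑' n, t n * F n x * F n y) = ∑' n, t n * F n y * F n x) ∧
    (∀ x₁ x₂ y : B, (∑' n, t n * F n (x₁ + x₂) * F n y)
        = (∑' n, t n * F n x₁ * F n y) + ∑' n, t n * F n x₂ * F n y) ∧
    (∀ (c : ℝ) (x y : B),
        (∑' n, t n * F n (c • x) * F n y) = c * ∑' n, t n * F n x * F n y) ∧
    (∀ x : B, 0 ≤ ∑' n, t n * F n x * F n x) ∧
    (∀ x : B, (∑' n, t n * F n x * F n x) = 0 → x = 0) ∧
    (∀ x : B, (∑' n, t n * (F n x) ^ 2) ≤ ‖x‖ ^ 2) := by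
  have hF_le (n : ℕ) (x : B) : |F n x| ≤ ‖x‖ := by
    simpa using (F n).le_of_opNorm_le (hF n) x
  have habs (x y : B) : Summable fun n => |t n * F n x * F n y| := by
    refine Summable.of_nonneg_of_le (fun n => abs_nonneg _) (fun n => ?_)
      (hsum.summable.mul_right (‖x‖ * ‖y‖))
    rw [abs_mul, abs_mul, abs_of_pos (ht n), mul_assoc]
    have := (ht n).le
    gcongr
    · exact hF_le n x
    · exact hF_le n y
  have hs (x y : B) : Summable fun n => t n * F n x * F n y := (habs x y).of_abs
  have hnonneg (x : B) (n : ℕ) : 0 ≤ t n * F n x * F n x := by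
    rw [mul_assoc]
    exact mul_nonneg (ht n).le (mul_self_nonneg _)
  refine ⟨habs, fun x y => tsum_congr fun n => by ring, fun x₁ x₂ y => ?_, fun c x y => ?_,
    fun x => tsum_nonneg (hnonneg x), fun x hx => ?_, fun x => ?_⟩
  · rw [← (hs x₁ y).tsum_add (hs x₂ y)]
    exact tsum_congr fun n => by rw [map_add]; ring
  · rw [← tsum_mul_left]
    exact tsum_congr fun n => by rw [map_smul, smul_eq_mul]; ring
  · have hzero : (fun n => t n * F n x * F n x) = 0 :=
      (hasSum_zero_iff_of_nonneg (hnonneg x)).1 (hx ▸ (hs x x).hasSum)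
    have hFx (n : ℕ) : F n x = 0 := by
      simpa [(ht n).ne'] using congrFun hzero n
    simpa [hFx] using hnorm x
  · have hbound := hsum.mul_right (‖x‖ ^ 2)
    rw [one_mul] at hbound
    have hsq : Summable fun n => t n * F n x ^ 2 :=
      (hs x x).congr fun n => by ring
    refine hasSum_le (fun n => ?_) hsq.hasSum hbound
    exact mul_le_mul_of_nonneg_left (sq_le_sq.2 (by simpa using hF_le n x)) (ht n).le
end

section
/- Let H̃ be a separable real Hilbert space, (e_j)_{j≥1} and (f_j)_{j≥1} two orthonormal bases of H̃ with Σ_{j=1}^∞ ‖e_j − f_j‖² < ∞, (C_j)_{j≥1} and (C'_j)_{j≥1} bounded sequences of nonnegative reals, N ≥ 0, and F, G ∈ H̃ with ‖F‖² ≤ N and ‖G‖² ≤ N. Then |Σ_{j=1}^∞ (C_j ⟨F, e_j⟩⟨G, e_j⟩ − C'_j ⟨F, f_j⟩⟨G, f_j⟩)| ≤ N [ sup_{j≥1} |C_j − C'_j| + (sup_{j≥1} C_j + sup_{j≥1} C'_j) · √(Σ_{j=1}^∞ ‖e_j − f_j‖²) ]. -/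
open scoped RealInnerProductSpace

lemma Finset.sum_abs_mul_abs_le_of_sum_sq_le {ι : Type*} (s : Finset ι) {u v : ι → ℝ} {A B : ℝ}
    (hA : 0 ≤ A) (hB : 0 ≤ B) (hu : ∑ j ∈ s, u j ^ 2 ≤ A ^ 2) (hv : ∑ j ∈ s, v j ^ 2 ≤ B ^ 2) :
    ∑ j ∈ s, |u j| * |v j| ≤ A * B := by
  refine (Real.sum_mul_le_sqrt_mul_sqrt s _ _).trans ?_
  simp only [sq_abs]
  exact mul_le_mul (Real.sqrt_le_iff.2 ⟨hA, hu⟩) (Real.sqrt_le_iff.2 ⟨hB, hv⟩)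
    (Real.sqrt_nonneg _) hA

lemma abs_tsum_le_of_sum_abs_le {ι : Type*} {g : ι → ℝ} {B : ℝ}
    (h : ∀ s : Finset ι, ∑ j ∈ s, |g j| ≤ B) : |∑' j, g j| ≤ B := by
  have hs : Summable fun j => ‖g j‖ := summable_of_sum_le (fun _ => norm_nonneg _) h
  exact (norm_tsum_le_tsum_norm hs).trans (hs.tsum_le_of_sum_le h)

lemma Orthonormal.sum_inner_sq_le {ι H : Type*} [NormedAddCommGroup H] [InnerProductSpace ℝ H]
    {e : ι → H} (he : Orthonormal ℝ e) (x : H) (s : Finset ι) :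
    ∑ j ∈ s, ⟪x, e j⟫ ^ 2 ≤ ‖x‖ ^ 2 := by
  simpa [real_inner_comm] using he.sum_inner_products_le x (s := s)

lemma sum_inner_sq_le_of_summable_norm_sq {ι H : Type*} [NormedAddCommGroup H]
    [InnerProductSpace ℝ H] {d : ι → H} (hd : Summable fun j => ‖d j‖ ^ 2) (x : H)
    (s : Finset ι) :
    ∑ j ∈ s, ⟪x, d j⟫ ^ 2 ≤ (‖x‖ * √(∑' j, ‖d j‖ ^ 2)) ^ 2 := by
  rw [mul_pow, Real.sq_sqrt (tsum_nonneg fun _ => sq_nonneg _)]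
  calc ∑ j ∈ s, ⟪x, d j⟫ ^ 2 ≤ ∑ j ∈ s, ‖x‖ ^ 2 * ‖d j‖ ^ 2 := by
        refine Finset.sum_le_sum fun j _ => ?_
        rw [← mul_pow]
        exact sq_le_sq' (neg_le_of_abs_le (abs_real_inner_le_norm _ _)) (real_inner_le_norm _ _)
    _ = ‖x‖ ^ 2 * ∑ j ∈ s, ‖d j‖ ^ 2 := (Finset.mul_sum ..).symm
    _ ≤ _ := by
        gcongr
        exact hd.sum_le_tsum s fun _ _ => sq_nonneg _

/-- Key deterministic inequality of Lemma 6: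
`|Σ_j (C_j ⟨F, e_j⟩⟨G, e_j⟩ − C'_j ⟨F, f_j⟩⟨G, f_j⟩)|
  ≤ N [ sup_j |C_j − C'_j| + (sup_j C_j + sup_j C'_j) √(Σ_j ‖e_j − f_j‖²) ]`. -/
theorem kernel_difference_bound (H : Type) [NormedAddCommGroup H] [InnerProductSpace ℝ H]
    [CompleteSpace H] [TopologicalSpace.SeparableSpace H]
    (e f : ℕ → H) (he : Orthonormal ℝ e) (hf : Orthonormal ℝ f)
    (he' : (Submodule.span ℝ (Set.range e)).topologicalClosure = ⊤)
    (hf' : (Submodule.span ℝ (Set.range f)).topologicalClosure = ⊤)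
    (hef : Summable fun j => ‖e j - f j‖ ^ 2)
    (C C' : ℕ → ℝ) (hC : ∀ j, 0 ≤ C j) (hC' : ∀ j, 0 ≤ C' j)
    (hCbdd : BddAbove (Set.range C)) (hC'bdd : BddAbove (Set.range C'))
    (N : ℝ) (hN : 0 ≤ N)
    (F G : H) (hFN : ‖F‖ ^ 2 ≤ N) (hGN : ‖G‖ ^ 2 ≤ N) :
    |∑' j, (C j * ⟪F, e j⟫ * ⟪G, e j⟫ - C' j * ⟪F, f j⟫ * ⟪G, f j⟫)|
      ≤ N * ((⨆ j, |C j - C' j|)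
        + ((⨆ j, C j) + ⨆ j, C' j) * Real.sqrt (∑' j, ‖e j - f j‖ ^ 2)) := by
  have hbdd : BddAbove (Set.range fun j => |C j - C' j|) := by
    obtain ⟨a, ha⟩ := hCbdd
    obtain ⟨b, hb⟩ := hC'bdd
    refine ⟨a + b, ?_⟩
    rintro _ ⟨j, rfl⟩
    have h1 := ha ⟨j, rfl⟩
    have h2 := hb ⟨j, rfl⟩
    have h3 := hC j
    have h4 := hC' j
    exact abs_le.2 ⟨by linarith, by linarith⟩
  set D := ⨆ j, |C j - C' j|
  set M := ⨆ j, C j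
  set M' := ⨆ j, C' j
  set S := √(∑' j, ‖e j - f j‖ ^ 2)
  have hD (j) : |C j - C' j| ≤ D := le_ciSup hbdd j
  have hM (j) : C j ≤ M := le_ciSup hCbdd j
  have hM' (j) : C' j ≤ M' := le_ciSup hC'bdd j
  have hD0 : 0 ≤ D := (abs_nonneg _).trans (hD 0)
  have hM0 : 0 ≤ M := (hC 0).trans (hM 0)
  have hM'0 : 0 ≤ M' := (hC' 0).trans (hM' 0)
  have hS0 : 0 ≤ S := Real.sqrt_nonneg _
  have hFG : ‖F‖ * ‖G‖ ≤ N := by nlinarith [sq_nonneg (‖F‖ - ‖G‖)]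
  refine abs_tsum_le_of_sum_abs_le fun s => ?_
  have h1 : ∑ j ∈ s, |⟪F, e j⟫| * |⟪G, f j⟫| ≤ ‖F‖ * ‖G‖ :=
    s.sum_abs_mul_abs_le_of_sum_sq_le (norm_nonneg _) (norm_nonneg _)
      (he.sum_inner_sq_le F s) (hf.sum_inner_sq_le G s)
  have h2 : ∑ j ∈ s, |⟪F, e j⟫| * |⟪G, e j - f j⟫| ≤ ‖F‖ * (‖G‖ * S) :=
    s.sum_abs_mul_abs_le_of_sum_sq_le (norm_nonneg _) (by positivity)
      (he.sum_inner_sq_le F s) (sum_inner_sq_le_of_summable_norm_sq hef G s)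
  have h3 : ∑ j ∈ s, |⟪F, e j - f j⟫| * |⟪G, f j⟫| ≤ ‖F‖ * S * ‖G‖ :=
    s.sum_abs_mul_abs_le_of_sum_sq_le (by positivity) (norm_nonneg _)
      (sum_inner_sq_le_of_summable_norm_sq hef F s) (hf.sum_inner_sq_le G s)
  calc ∑ j ∈ s, |C j * ⟪F, e j⟫ * ⟪G, e j⟫ - C' j * ⟪F, f j⟫ * ⟪G, f j⟫|
      ≤ ∑ j ∈ s, (D * (|⟪F, e j⟫| * |⟪G, f j⟫|) + M * (|⟪F, e j⟫| * |⟪G, e j - f j⟫|)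
          + M' * (|⟪F, e j - f j⟫| * |⟪G, f j⟫|)) := by
        refine Finset.sum_le_sum fun j _ => ?_
        have hsplit : C j * ⟪F, e j⟫ * ⟪G, e j⟫ - C' j * ⟪F, f j⟫ * ⟪G, f j⟫
            = (C j - C' j) * (⟪F, e j⟫ * ⟪G, f j⟫) + C j * (⟪F, e j⟫ * ⟪G, e j - f j⟫)
              + C' j * (⟪F, e j - f j⟫ * ⟪G, f j⟫) := by
          simp only [inner_sub_right]
          ring
        rw [hsplit]
        refine (abs_add_three _ _ _).trans ?_
        simp only [abs_mul, abs_of_nonneg (hC j), abs_of_nonneg (hC' j)]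
        gcongr
        exacts [hD j, hM j, hM' j]
    _ = D * ∑ j ∈ s, |⟪F, e j⟫| * |⟪G, f j⟫| + M * ∑ j ∈ s, |⟪F, e j⟫| * |⟪G, e j - f j⟫|
          + M' * ∑ j ∈ s, |⟪F, e j - f j⟫| * |⟪G, f j⟫| := by
        simp only [Finset.sum_add_distrib, Finset.mul_sum]
    _ ≤ D * (‖F‖ * ‖G‖) + M * (‖F‖ * (‖G‖ * S)) + M' * (‖F‖ * S * ‖G‖) := by gcongr
    _ = ‖F‖ * ‖G‖ * (D + (M + M') * S) := by ring
    _ ≤ N * (D + (M + M') * S) := by gcongr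
end

section
/- Let H̃ be a real Hilbert space, B a real normed space, and ι : B → H̃ an injective linear map with ‖ι x‖_{H̃} ≤ ‖x‖_B for all x ∈ B. Let k ≥ 1, V ≥ 0, and let ê_1, …, ê_k, f̂_1, …, f̂_k ∈ B with ‖ê_j‖_B ≤ V and ‖f̂_j‖_B ≤ V be such that both (e_j := ι ê_j)_{j≤k} and (f_j := ι f̂_j)_{j≤k} are orthonormal families in H̃. Let C, C_n, D, D_n, ρ be bounded linear operators on H̃ with D = ρ ∘ C. Assume: C e_j = C_j e_j with reals C_1 ≥ C_2 ≥ ⋯ ≥ C_k > 0; C_n f_j = C_{n,j} f_j with C_{n,j} ≥ C_k/2 for all j ≤ k; |C_{n,j} − C_j| ≤ ‖C_n − C‖_{L(H̃)} for all j ≤ k; and there are positive reals a_1, …, a_k with 1/C_j ≤ a_j and ‖f_j − e_j‖_{H̃} ≤ a_j ‖C_n − C‖_{L(H̃)} for all j ≤ k. Then for every x ∈ B with ‖x‖_B ≤ 1, ‖ Σ_{j=1}^k Σ_{p=1}^k [ (1/C_{n,j}) ⟨ι x, f_j⟩ ⟨D_n f_j, f_p⟩ − ⟨ι x, f_j⟩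 ⟨ρ f_j, f_p⟩ ] f̂_p ‖_B ≤ 2 V C_k^{-1} k² ‖D_n − D‖_{L(H̃)} + 2 V k (Σ_{j=1}^k a_j) ( (5/2) C_k^{-1} ‖D‖_{L(H̃)} + ‖ρ‖_{L(H̃)} ) ‖C_n − C‖_{L(H̃)}. -/
open scoped RealInnerProductSpace

/-- Error of the plug-in image `μ⁻¹ • T' f` of an approximate eigenvector `f` as an estimate of
`R f`, where `T = R ∘ A` and `A e = l • e`. -/
lemma norm_inv_smul_sub_le {H : Type*} [NormedAddCommGroup H] [NormedSpace ℝ H]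
    {A T T' R : H →L[ℝ] H} (hT : T = R.comp A) {e f : H} (he : ‖e‖ = 1) (hf : ‖f‖ = 1)
    {l μ c b δ : ℝ} (hAe : A e = l • e) (hc : 0 < c) (hl : 0 < l) (hμ : c / 2 ≤ μ)
    (hδ : |μ - l| ≤ δ) (hb : 1 / l ≤ b) (hfe : ‖f - e‖ ≤ b * δ) :
    ‖(1 / μ) • T' f - R f‖ ≤
      2 * c⁻¹ * ‖T' - T‖ + (4 * c⁻¹ * ‖T‖ + ‖R‖) * (b * δ) := by
  have hμ0 : 0 < μ := by linarith
  have hTe : T e = l • R e := by simp [hT, hAe]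
  have hinv : 1 / μ ≤ 2 * c⁻¹ := by
    rw [← div_eq_mul_inv, div_le_div_iff₀ hμ0 hc]
    linarith
  have hδ0 : 0 ≤ δ := (abs_nonneg _).trans hδ
  have hsplit : (1 / μ) • T' f - R f =
      (1 / μ) • ((T' - T) f + (T (f - e) + ((l - μ) * (1 / l)) • T e)) - R (f - e) := by
    simp only [map_sub, sub_apply, hTe]
    match_scalars <;> field_simp <;> ring
  have h₁ : ‖(T' - T) f‖ ≤ ‖T' - T‖ := by simpa [hf] using (T' - T).le_opNorm f
  have h₂ : ‖T (f - e)‖ ≤ ‖T‖ * (b * δ) := T.le_opNorm_of_le hfe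
  have h₃ : ‖R (f - e)‖ ≤ ‖R‖ * (b * δ) := R.le_opNorm_of_le hfe
  have h₄ : ‖((l - μ) * (1 / l)) • T e‖ ≤ ‖T‖ * (b * δ) := by
    have hTe' : ‖T e‖ ≤ ‖T‖ := by simpa [he] using T.le_opNorm e
    have hcoef : |l - μ| * (1 / l) ≤ b * δ := by
      rw [abs_sub_comm, mul_comm b]
      gcongr
    rw [norm_smul, Real.norm_eq_abs, abs_mul, abs_of_pos (one_div_pos.2 hl), mul_comm]
    gcongr
  calc ‖(1 / μ) • T' f - R f‖
      ≤ (1 / μ) * (‖(T' - T) f‖ + (‖T (f - e)‖ + ‖((l - μ) * (1 / l)) • T e‖))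
          + ‖R (f - e)‖ := by
        rw [hsplit]
        refine (norm_sub_le _ _).trans ?_
        rw [norm_smul, Real.norm_of_nonneg (one_div_pos.2 hμ0).le]
        gcongr
        exact (norm_add_le _ _).trans (by gcongr; exact norm_add_le _ _)
    _ ≤ 2 * c⁻¹ * (‖T' - T‖ + (‖T‖ * (b * δ) + ‖T‖ * (b * δ))) + ‖R‖ * (b * δ) := by
        gcongr
    _ = _ := by ring

/-- Deterministic core (Eq. (eq7mth)) of the proof of Theorem 1: bound in `B`-norm
of the difference between the component-wise plug-in estimator and the projected
autocorrelation operator. -/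
theorem plugin_estimator_bound (H : Type) [NormedAddCommGroup H] [InnerProductSpace ℝ H]
    [CompleteSpace H]
    (B : Type) [NormedAddCommGroup B] [NormedSpace ℝ B]
    (ι : B →ₗ[ℝ] H) (hιinj : Function.Injective ι) (hι : ∀ x : B, ‖ι x‖ ≤ ‖x‖)
    (k : ℕ) (hk : 0 < k) (V : ℝ) (hV : 0 ≤ V)
    (ehat fhat : Fin k → B)
    (heV : ∀ j, ‖ehat j‖ ≤ V) (hfV : ∀ j, ‖fhat j‖ ≤ V)
    (he : Orthonormal ℝ fun j => ι (ehat j))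
    (hf : Orthonormal ℝ fun j => ι (fhat j))
    (C Cn D Dn ρ : H →L[ℝ] H) (hD : D = ρ.comp C)
    (Cv Cnv : Fin k → ℝ)
    (hCe : ∀ j, C (ι (ehat j)) = Cv j • ι (ehat j))
    (hCvmono : ∀ i j : Fin k, i ≤ j → Cv j ≤ Cv i)
    (hCk : 0 < Cv ⟨k - 1, Nat.sub_lt hk Nat.one_pos⟩)
    (hCnf : ∀ j, Cn (ι (fhat j)) = Cnv j • ι (fhat j))
    (hCnv : ∀ j, Cv ⟨k - 1, Nat.sub_lt hk Nat.one_pos⟩ / 2 ≤ Cnv j)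
    (hdiff : ∀ j, |Cnv j - Cv j| ≤ ‖Cn - C‖)
    (a : Fin k → ℝ) (ha : ∀ j, 0 < a j) (hainv : ∀ j, 1 / Cv j ≤ a j)
    (hperturb : ∀ j, ‖ι (fhat j) - ι (ehat j)‖ ≤ a j * ‖Cn - C‖) :
    ∀ x : B, ‖x‖ ≤ 1 →
      ‖∑ j : Fin k, ∑ p : Fin k,
          ((1 / Cnv j) * ⟪ι x, ι (fhat j)⟫ * ⟪Dn (ι (fhat j)), ι (fhat p)⟫
            - ⟪ι x, ι (fhat j)⟫ * ⟪ρ (ι (fhat j)), ι (fhat p)⟫) • fhat p‖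
        ≤ 2 * V * (Cv ⟨k - 1, Nat.sub_lt hk Nat.one_pos⟩)⁻¹ * (k : ℝ) ^ 2 * ‖Dn - D‖
          + 2 * V * (k : ℝ) * (∑ j : Fin k, a j)
            * ((5 / 2) * (Cv ⟨k - 1, Nat.sub_lt hk Nat.one_pos⟩)⁻¹ * ‖D‖ + ‖ρ‖)
            * ‖Cn - C‖ := by
  intro x hx
  set c := Cv ⟨k - 1, Nat.sub_lt hk Nat.one_pos⟩
  set δ := ‖Cn - C‖
  have hw : ∀ j, ‖(1 / Cnv j) • Dn (ι (fhat j)) - ρ (ι (fhat j))‖ ≤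
      2 * c⁻¹ * ‖Dn - D‖ + (4 * c⁻¹ * ‖D‖ + ‖ρ‖) * (a j * δ) := fun j =>
    norm_inv_smul_sub_le hD (he.1 j) (hf.1 j) (hCe j) hCk
      (hCk.trans_le (hCvmono _ _ (Fin.mk_le_mk.2 (Nat.le_sub_one_of_lt j.2)))) (hCnv j)
      (hdiff j) (hainv j) (hperturb j)
  have hterm : ∀ j p : Fin k,
      ‖((1 / Cnv j) * ⟪ι x, ι (fhat j)⟫ * ⟪Dn (ι (fhat j)), ι (fhat p)⟫
        - ⟪ι x, ι (fhat j)⟫ * ⟪ρ (ι (fhat j)), ι (fhat p)⟫) • fhat p‖ ≤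
      (2 * c⁻¹ * ‖Dn - D‖ + 2 * ((5 / 2) * c⁻¹ * ‖D‖ + ‖ρ‖) * (a j * δ)) * V := by
    intro j p
    have hcoef : (1 / Cnv j) * ⟪ι x, ι (fhat j)⟫ * ⟪Dn (ι (fhat j)), ι (fhat p)⟫
        - ⟪ι x, ι (fhat j)⟫ * ⟪ρ (ι (fhat j)), ι (fhat p)⟫ = ⟪ι x, ι (fhat j)⟫ *
          ⟪(1 / Cnv j) • Dn (ι (fhat j)) - ρ (ι (fhat j)), ι (fhat p)⟫ := by
      rw [inner_sub_left, real_inner_smul_left]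
      ring
    have h₁ : |⟪ι x, ι (fhat j)⟫| ≤ 1 := by
      have h := abs_real_inner_le_norm (ι x) (ι (fhat j))
      rw [hf.1 j, mul_one] at h
      exact h.trans ((hι x).trans hx)
    have h₂ := abs_real_inner_le_norm
      ((1 / Cnv j) • Dn (ι (fhat j)) - ρ (ι (fhat j))) (ι (fhat p))
    rw [hf.1 p, mul_one] at h₂
    have haδ : 0 ≤ a j * δ := mul_nonneg (ha j).le (norm_nonneg _)
    have hweak : 4 * c⁻¹ * ‖D‖ + ‖ρ‖ ≤ 2 * ((5 / 2) * c⁻¹ * ‖D‖ + ‖ρ‖) := by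
      have : 0 ≤ c⁻¹ * ‖D‖ := by positivity
      linarith [norm_nonneg ρ]
    rw [hcoef, norm_smul, Real.norm_eq_abs, abs_mul]
    refine mul_le_mul ?_ (hfV p) (norm_nonneg _) (by positivity)
    calc _ ≤ 1 * ‖(1 / Cnv j) • Dn (ι (fhat j)) - ρ (ι (fhat j))‖ := by gcongr
      _ ≤ _ := by
        rw [one_mul]
        exact (hw j).trans (by gcongr)
  refine (norm_sum_le_of_le _ fun j _ => norm_sum_le_of_le _ fun p _ => hterm j p).trans_eq ?_
  simp only [Finset.sum_const, Finset.card_univ, Fintype.card_fin, nsmul_eq_mul,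
    ← Finset.mul_sum, ← Finset.sum_mul, Finset.sum_add_distrib]
  ring
end

section
/- Let H̃ be a real Hilbert space, B a real normed space, ι : B → H̃ a linear map with ‖ι x‖_{H̃} ≤ ‖x‖_B for all x ∈ B, and ρ : B → B a linear map for which there exists R ≥ 0 with ‖ι(ρ x)‖_{H̃} ≤ R ‖ι x‖_{H̃} for all x ∈ B. For each n, let k_n ∈ ℕ and let φ_{n,1}, …, φ_{n,k_n} and φ'_{n,1}, …, φ'_{n,k_n} be elements of B with ‖ι φ_{n,j}‖_{H̃} ≤ 1, ‖ι φ'_{n,j}‖_{H̃} ≤ 1 and ‖φ'_{n,j}‖_B ≤ V for some V ≥ 0 independent of n and j. Assume: (i) sup_{x∈B, ‖x‖_B≤1} ‖ ρ(x) − Σ_{j=1}^{k_n} ⟨ι(ρ x), ι φ'_{n,j}⟩_{H̃} φ'_{n,j} ‖_B → 0 as n → ∞; and (ii) Σ_{j=1}^{k_n} ‖φ_{n,j} − φ'_{n,j}‖_B → 0 as n → ∞. Then sup_{x∈B, ‖x‖_B≤1} ‖ ρ(x) − Σ_{j=1}^{k_n} ⟨ι(ρ x), ι φ_{n,j}⟩_{H̃}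 φ_{n,j} ‖_B → 0 as n → ∞. -/
open scoped RealInnerProductSpace

/-- A rank-one operator `y ↦ ⟪y, ι a⟫ • a` depends Lipschitz-continuously on `a`. -/
theorem norm_inner_smul_sub_inner_smul_le {H B : Type*} [NormedAddCommGroup H]
    [InnerProductSpace ℝ H] [NormedAddCommGroup B] [NormedSpace ℝ B]
    (ι : B →ₗ[ℝ] H) (hι : ∀ x : B, ‖ι x‖ ≤ ‖x‖) {V : ℝ} {a b : B}
    (ha : ‖ι a‖ ≤ 1) (hb : ‖b‖ ≤ V) (y : H) :
    ‖⟪y, ι b⟫ • b - ⟪y, ι a⟫ • a‖ ≤ ‖y‖ * (V + 1) * ‖a - b‖ := by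
  have hsplit : ⟪y, ι b⟫ • b - ⟪y, ι a⟫ • a
      = -(⟪y, ι (a - b)⟫ • b + ⟪y, ι a⟫ • (a - b)) := by
    rw [map_sub, inner_sub_right]
    module
  have hab : |⟪y, ι (a - b)⟫| ≤ ‖y‖ * ‖a - b‖ :=
    (abs_real_inner_le_norm _ _).trans (by gcongr; exact hι _)
  have hya : |⟪y, ι a⟫| ≤ ‖y‖ * 1 :=
    (abs_real_inner_le_norm _ _).trans (by gcongr)
  calc ‖⟪y, ι b⟫ • b - ⟪y, ι a⟫ • a‖
      ≤ |⟪y, ι (a - b)⟫| * ‖b‖ + |⟪y, ι a⟫| * ‖a - b‖ := by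
        rw [hsplit, norm_neg]
        refine (norm_add_le _ _).trans_eq ?_
        rw [norm_smul, norm_smul, Real.norm_eq_abs, Real.norm_eq_abs]
    _ ≤ (‖y‖ * ‖a - b‖) * V + (‖y‖ * 1) * ‖a - b‖ := by gcongr
    _ = ‖y‖ * (V + 1) * ‖a - b‖ := by ring

/-- Lemma 8 of the paper: if the projections of `ρ` onto the sign-corrected
eigenvectors `φ'_{n,j}` converge to `ρ` uniformly on the unit ball of `B`
(Assumption A3), and `Σ_{j≤k_n} ‖φ_{n,j} − φ'_{n,j}‖_B → 0`, then the
projections onto the empirical eigenvectors `φ_{n,j}` also converge to `ρ`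
uniformly on the unit ball of `B`. -/
theorem projection_transfer (H : Type) [NormedAddCommGroup H] [InnerProductSpace ℝ H]
    [CompleteSpace H]
    (B : Type) [NormedAddCommGroup B] [NormedSpace ℝ B]
    (ι : B →ₗ[ℝ] H) (hι : ∀ x : B, ‖ι x‖ ≤ ‖x‖)
    (ρ : B →ₗ[ℝ] B) (R : ℝ) (hR : 0 ≤ R) (hρ : ∀ x : B, ‖ι (ρ x)‖ ≤ R * ‖ι x‖)
    (k : ℕ → ℕ) (φ φ' : (n : ℕ) → Fin (k n) → B)
    (hφ : ∀ n j, ‖ι (φ n j)‖ ≤ 1) (hφ' : ∀ n j, ‖ι (φ' n j)‖ ≤ 1)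
    (V : ℝ) (hV : 0 ≤ V) (hφ'B : ∀ n j, ‖φ' n j‖ ≤ V)
    (hA3 : ∀ ε > (0 : ℝ), ∃ N : ℕ, ∀ n ≥ N, ∀ x : B, ‖x‖ ≤ 1 →
      ‖ρ x - ∑ j : Fin (k n), ⟪ι (ρ x), ι (φ' n j)⟫ • φ' n j‖ < ε)
    (hconv : Filter.Tendsto (fun n => ∑ j : Fin (k n), ‖φ n j - φ' n j‖)
      Filter.atTop (nhds 0)) :
    ∀ ε > (0 : ℝ), ∃ N : ℕ, ∀ n ≥ N, ∀ x : B, ‖x‖ ≤ 1 →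
      ‖ρ x - ∑ j : Fin (k n), ⟪ι (ρ x), ι (φ n j)⟫ • φ n j‖ < ε := by
  intro ε hε
  have hlim : Filter.Tendsto (fun n => R * (V + 1) * ∑ j : Fin (k n), ‖φ n j - φ' n j‖)
      Filter.atTop (nhds 0) := by
    simpa using hconv.const_mul (R * (V + 1))
  obtain ⟨N₁, hN₁⟩ := hA3 (ε / 2) (half_pos hε)
  obtain ⟨N₂, hN₂⟩ := Filter.eventually_atTop.1 (hlim.eventually_lt_const (half_pos hε))
  refine ⟨max N₁ N₂, fun n hn x hx => ?_⟩
  have hρx : ‖ι (ρ x)‖ ≤ R :=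
    (hρ x).trans (mul_le_of_le_one_right hR ((hι x).trans hx))
  have hdiff : ‖∑ j : Fin (k n), ⟪ι (ρ x), ι (φ' n j)⟫ • φ' n j
      - ∑ j : Fin (k n), ⟪ι (ρ x), ι (φ n j)⟫ • φ n j‖
      ≤ R * (V + 1) * ∑ j : Fin (k n), ‖φ n j - φ' n j‖ := by
    rw [← Finset.sum_sub_distrib, Finset.mul_sum]
    refine norm_sum_le_of_le _ fun j _ => ?_
    refine (norm_inner_smul_sub_inner_smul_le ι hι (hφ n j) (hφ'B n j) _).trans ?_
    gcongr
  calc _ ≤ _ := norm_sub_le_norm_sub_add_norm_sub _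
        (∑ j : Fin (k n), ⟪ι (ρ x), ι (φ' n j)⟫ • φ' n j) _
    _ < ε / 2 + ε / 2 :=
        add_lt_add (hN₁ n (le_of_max_le_left hn) x hx)
          (hdiff.trans_lt (hN₂ n (le_of_max_le_right hn)))
    _ = ε := add_halves ε
end
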